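/- arXiv:2311.12322 — 3 statements merged into one kernel-verified Lean document; each statement's English description precedes it below -/
import Mathlib

section
/- Let n, m be positive integers, A, C be n×n real matrices, B, D be n×m real matrices, σ > 0, and K be an m×n real matrix; write F = A + BK and G = C + DK. Suppose there exists a symmetric positive definite n×n matrix P₀ such that Fᵀ P₀ F + σ² Gᵀ P₀ G − P₀ is negative definite. If M is a positive semidefinite (respectively positive definite) n×n matrix and P is a symmetric matrix satisfying P = Fᵀ P F + σ² Gᵀ P G + M, then P is positive semidefinite (respectively positive definite). -/
open Matrix Filter

lemma quad_conj {n : ℕ} (F P : Matrix (Fin n) (Fin n) ℝ) (x : Fin n → ℝ) :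
    x ⬝ᵥ ((Fᵀ * P * F) *ᵥ x) = (F *ᵥ x) ⬝ᵥ (P *ᵥ (F *ᵥ x)) := by
  rw [← Matrix.mulVec_mulVec, ← Matrix.mulVec_mulVec, Matrix.dotProduct_mulVec,
    Matrix.vecMul_transpose]

lemma quad_smul {n : ℕ} (P : Matrix (Fin n) (Fin n) ℝ) (c : ℝ) (x : Fin n → ℝ) :
    (c • x) ⬝ᵥ (P *ᵥ (c • x)) = c ^ 2 * (x ⬝ᵥ (P *ᵥ x)) := by
  rw [Matrix.mulVec_smul, smul_dotProduct, dotProduct_smul, smul_eq_mul, smul_eq_mul]; ring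

lemma quad_min {n : ℕ} (hn : 0 < n) (P Q : Matrix (Fin n) (Fin n) ℝ)
    (hQ : ∀ x : Fin n → ℝ, x ≠ 0 → 0 < x ⬝ᵥ (Q *ᵥ x)) :
    ∃ (l : ℝ) (x : Fin n → ℝ), x ≠ 0 ∧ x ⬝ᵥ (P *ᵥ x) = l * (x ⬝ᵥ (Q *ᵥ x)) ∧
      ∀ y : Fin n → ℝ, l * (y ⬝ᵥ (Q *ᵥ y)) ≤ y ⬝ᵥ (P *ᵥ y) := by
  haveI : Nonempty (Fin n) := ⟨⟨0, hn⟩⟩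
  have hc : ∀ R : Matrix (Fin n) (Fin n) ℝ, Continuous fun x : Fin n → ℝ => x ⬝ᵥ (R *ᵥ x) := by
    intro R
    exact continuous_id.dotProduct (continuous_const.matrix_mulVec continuous_id)
  have hne : (Metric.sphere (0 : Fin n → ℝ) 1).Nonempty :=
    NormedSpace.sphere_nonempty.2 zero_le_one
  have hs0 : ∀ x ∈ Metric.sphere (0 : Fin n → ℝ) 1, x ≠ 0 := by
    rintro x hx rfl
    simp at hx
  obtain ⟨x, hx, hmin⟩ := (isCompact_sphere (0 : Fin n → ℝ) 1).exists_isMinOn hne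
    (f := fun x => (x ⬝ᵥ (P *ᵥ x)) / (x ⬝ᵥ (Q *ᵥ x)))
    ((hc P).continuousOn.div (hc Q).continuousOn (fun x hx => (hQ x (hs0 x hx)).ne'))
  refine ⟨(x ⬝ᵥ (P *ᵥ x)) / (x ⬝ᵥ (Q *ᵥ x)), x, hs0 x hx, ?_, ?_⟩
  · rw [div_mul_cancel₀ _ (hQ x (hs0 x hx)).ne']
  · intro y
    by_cases hy : y = 0
    · subst hy; simp
    have hny : ‖y‖ ≠ 0 := norm_ne_zero_iff.2 hy
    have hu : (‖y‖⁻¹ • y) ∈ Metric.sphere (0 : Fin n → ℝ) 1 := by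
      simp [norm_smul, hny]
    have h := isMinOn_iff.1 hmin _ hu
    simp only [quad_smul] at h
    rw [mul_div_mul_left _ _ (pow_ne_zero 2 (inv_ne_zero hny))] at h
    exact (le_div_iff₀ (hQ y hy)).1 h

theorem lyapunov_solution_posdef_of_source
    (n m : ℕ) (hn : 0 < n) (hm : 0 < m)
    (A C : Matrix (Fin n) (Fin n) ℝ) (B D : Matrix (Fin n) (Fin m) ℝ)
    (σ : ℝ) (hσ : 0 < σ) (K : Matrix (Fin m) (Fin n) ℝ)
    (F G : Matrix (Fin n) (Fin n) ℝ)
    (hF : F = A + B * K) (hG : G = C + D * K)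
    (P₀ : Matrix (Fin n) (Fin n) ℝ) (hP₀ : P₀.PosDef)
    (hstab : (-(Fᵀ * P₀ * F + σ ^ 2 • (Gᵀ * P₀ * G) - P₀)).PosDef) :
    ∀ M P : Matrix (Fin n) (Fin n) ℝ, P.IsSymm →
      P = Fᵀ * P * F + σ ^ 2 • (Gᵀ * P * G) + M →
      (M.PosSemidef → P.PosSemidef) ∧ (M.PosDef → P.PosDef) := by
  intro M P hP hE
  have hQ : ∀ x : Fin n → ℝ, x ≠ 0 → 0 < x ⬝ᵥ (P₀ *ᵥ x) := fun x hx => by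
    simpa using hP₀.dotProduct_mulVec_pos hx
  have hS : ∀ x : Fin n → ℝ, x ≠ 0 →
      (F *ᵥ x) ⬝ᵥ (P₀ *ᵥ (F *ᵥ x)) + σ ^ 2 * ((G *ᵥ x) ⬝ᵥ (P₀ *ᵥ (G *ᵥ x)))
        < x ⬝ᵥ (P₀ *ᵥ x) := fun x hx => by
    have h := hstab.dotProduct_mulVec_pos hx
    simp only [star_trivial, Matrix.neg_mulVec, Matrix.sub_mulVec, Matrix.add_mulVec,
      Matrix.smul_mulVec, dotProduct_neg, dotProduct_sub, dotProduct_add, dotProduct_smul,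
      quad_conj, smul_eq_mul] at h
    linarith
  have hEq : ∀ x : Fin n → ℝ, x ⬝ᵥ (P *ᵥ x) =
      (F *ᵥ x) ⬝ᵥ (P *ᵥ (F *ᵥ x)) + σ ^ 2 * ((G *ᵥ x) ⬝ᵥ (P *ᵥ (G *ᵥ x)))
        + x ⬝ᵥ (M *ᵥ x) := fun x => by
    have h := congrArg (fun R : Matrix (Fin n) (Fin n) ℝ => x ⬝ᵥ (R *ᵥ x)) hE
    simpa only [Matrix.add_mulVec, Matrix.smul_mulVec, dotProduct_add, dotProduct_smul,
      quad_conj, smul_eq_mul] using h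
  have hH : P.IsHermitian := by
    rw [Matrix.IsHermitian, Matrix.conjTranspose_eq_transpose_of_trivial]; exact hP
  have key : M.PosSemidef → ∀ y : Fin n → ℝ, 0 ≤ y ⬝ᵥ (P *ᵥ y) := by
    intro hM
    obtain ⟨l, x, hx, hl, hmin⟩ := quad_min hn P P₀ hQ
    have hl0 : 0 ≤ l := by
      by_contra! hneg
      have h1 := hmin (F *ᵥ x)
      have h2 := mul_le_mul_of_nonneg_left (hmin (G *ᵥ x)) (sq_nonneg σ)
      have h3 : 0 ≤ x ⬝ᵥ (M *ᵥ x) := by simpa using hM.dotProduct_mulVec_nonneg x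
      have h4 := mul_lt_mul_of_neg_left (hS x hx) hneg
      have h5 := hEq x
      linarith
    intro y
    refine le_trans ?_ (hmin y)
    by_cases hy : y = 0
    · subst hy; simp
    · exact mul_nonneg hl0 (hQ y hy).le
  refine ⟨fun hM => ?_, fun hM => ?_⟩
  · exact Matrix.PosSemidef.of_dotProduct_mulVec_nonneg hH (fun y => by simpa using key hM y)
  · refine Matrix.PosDef.of_dotProduct_mulVec_pos hH (fun y hy => ?_)
    have k := key hM.posSemidef
    have h3 : 0 < y ⬝ᵥ (M *ᵥ y) := by simpa using hM.dotProduct_mulVec_pos hy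
    have h6 := mul_nonneg (sq_nonneg σ) (k (G *ᵥ y))
    rw [star_trivial, hEq y]
    linarith [k (F *ᵥ y)]
end

section
/- Let n, m be positive integers, A, C ∈ ℝ^{n×n}, B, D ∈ ℝ^{n×m}, σ > 0, Q ∈ ℝ^{n×n} symmetric, S ∈ ℝ^{m×n}, R ∈ ℝ^{m×m} symmetric positive definite with Q − Sᵀ R⁻¹ S positive definite. Suppose K : ℕ → ℝ^{m×n} and P : ℕ → ℝ^{n×n} are sequences such that K(0) is a stabilizer and, for every i, P(i+1) is symmetric and satisfies (A+BK(i))ᵀ P(i+1) (A+BK(i)) + σ² (C+DK(i))ᵀ P(i+1) (C+DK(i)) + K(i)ᵀ R K(i) + K(i)ᵀ S + Sᵀ K(i) + Q − P(i+1) = 0, and K(i+1) = −(R + Bᵀ P(i+1) B + σ² Dᵀ P(i+1) D)⁻¹ (Bᵀ P(i+1) A + σ² Dᵀ P(i+1) C + S). Then the sequence (P(i)) converges to a symmetric positive definite matrix P∞ that satisfies the stochastic algebraic Riccati equation P∞ = Q + Aᵀ P∞ A + σ² Cᵀ P∞ C − (Bᵀ P∞ A + σ² Dᵀ P∞ C +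 S)ᵀ (R + Bᵀ P∞ B + σ² Dᵀ P∞ D)⁻¹ (Bᵀ P∞ A + σ² Dᵀ P∞ C + S), and the limiting gain K∞ = −(R + Bᵀ P∞ B + σ² Dᵀ P∞ D)⁻¹ (Bᵀ P∞ A + σ² Dᵀ P∞ C + S) is a stabilizer. -/
open Matrix Filter

/-- `K` is a (mean-square) stabilizer of the system `[A, C; B, D]` with noise
intensity `σ`, characterized by the Lyapunov criterion. -/
def IsStabilizer {n m : ℕ} (A C : Matrix (Fin n) (Fin n) ℝ)
    (B D : Matrix (Fin n) (Fin m) ℝ) (σ : ℝ)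
    (K : Matrix (Fin m) (Fin n) ℝ) : Prop :=
  ∃ P : Matrix (Fin n) (Fin n) ℝ, P.PosDef ∧
    (-((A + B * K)ᵀ * P * (A + B * K) +
        σ ^ 2 • ((C + D * K)ᵀ * P * (C + D * K)) - P)).PosDef

lemma aux_complete {n m : ℕ} (M : Matrix (Fin m) (Fin m) ℝ) (hM : M.PosDef)
    (N K : Matrix (Fin m) (Fin n) ℝ) :
    Kᵀ * M * K + Kᵀ * N + Nᵀ * K =
      (K + M⁻¹ * N)ᵀ * M * (K + M⁻¹ * N) - Nᵀ * M⁻¹ * N := by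
  have hu : IsUnit M.det := (Matrix.isUnit_iff_isUnit_det M).1 hM.isUnit
  have hs : Mᵀ = M := hM.isHermitian
  have h1 : M * (M⁻¹ * N) = N := by rw [← Matrix.mul_assoc, Matrix.mul_nonsing_inv _ hu, Matrix.one_mul]
  have h2 : M⁻¹ * (M * K) = K := by rw [← Matrix.mul_assoc, Matrix.nonsing_inv_mul _ hu, Matrix.one_mul]
  simp only [Matrix.transpose_add, Matrix.transpose_mul, Matrix.transpose_nonsing_inv, hs,
    Matrix.add_mul, Matrix.mul_add, Matrix.mul_assoc, h1, h2]
  abel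

lemma aux_sandwich {n m : ℕ} {M : Matrix (Fin m) (Fin m) ℝ} (hM : M.PosSemidef)
    (K : Matrix (Fin m) (Fin n) ℝ) : (Kᵀ * M * K).PosSemidef := by
  simpa using hM.conjTranspose_mul_mul_same K

lemma aux_cost {n m : ℕ} (Q : Matrix (Fin n) (Fin n) ℝ) (S : Matrix (Fin m) (Fin n) ℝ)
    (R : Matrix (Fin m) (Fin m) ℝ) (hR : R.PosDef) (hQS : (Q - Sᵀ * R⁻¹ * S).PosDef)
    (K : Matrix (Fin m) (Fin n) ℝ) : (Kᵀ * R * K + Kᵀ * S + Sᵀ * K + Q).PosDef := by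
  rw [aux_complete R hR]
  have := Matrix.PosDef.posSemidef_add (aux_sandwich hR.posSemidef (K + R⁻¹ * S)) hQS
  convert this using 1
  abel

lemma aux_L {n k : ℕ} (E G : Matrix (Fin n) (Fin k) ℝ) (σ : ℝ) {X : Matrix (Fin n) (Fin n) ℝ}
    (hX : X.PosSemidef) : (Eᵀ * X * E + σ ^ 2 • (Gᵀ * X * G)).PosSemidef :=
  (aux_sandwich hX E).add ((aux_sandwich hX G).smul (sq_nonneg σ))

lemma aux_compare {n : ℕ} (E G : Matrix (Fin n) (Fin n) ℝ) (σ : ℝ) (P X : Matrix (Fin n) (Fin n) ℝ)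
    (hP : P.PosDef) (hL : (-(Eᵀ * P * E + σ ^ 2 • (Gᵀ * P * G) - P)).PosDef)
    (hX : X.IsSymm) (hXL : (X - (Eᵀ * X * E + σ ^ 2 • (Gᵀ * X * G))).PosSemidef) :
    X.PosSemidef := by
  have hXh : X.IsHermitian := hX
  by_contra hcon
  have hex : ∃ x : Fin n → ℝ, x ⬝ᵥ (X *ᵥ x) < 0 := by
    by_contra! h
    exact hcon (Matrix.PosSemidef.of_dotProduct_mulVec_nonneg hXh (by simpa using h))
  obtain ⟨x, hx⟩ := hex
  have hPpos : ∀ y : Fin n → ℝ, y ≠ 0 → 0 < y ⬝ᵥ (P *ᵥ y) := fun y hy => by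
    simpa using hP.dotProduct_mulVec_pos hy
  have hx0 : x ≠ 0 := by rintro rfl; simp at hx
  have hmem : ∀ y : Fin n → ℝ, y ≠ 0 → ‖y‖⁻¹ • y ∈ Metric.sphere (0 : Fin n → ℝ) 1 := by
    intro y hy
    have : ‖y‖ ≠ 0 := norm_ne_zero_iff.2 hy
    simp [norm_smul, this]
  have hne : ∀ y ∈ Metric.sphere (0 : Fin n → ℝ) 1, y ≠ 0 := by
    rintro y hy rfl; simp at hy
  let f : (Fin n → ℝ) → ℝ := fun y => (y ⬝ᵥ (X *ᵥ y)) / (y ⬝ᵥ (P *ᵥ y))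
  have hscale : ∀ y : Fin n → ℝ, y ≠ 0 → f (‖y‖⁻¹ • y) = f y := by
    intro y hy
    have h1 : ‖y‖ ≠ 0 := norm_ne_zero_iff.2 hy
    have h2 := (hPpos y hy).ne'
    simp only [f, Matrix.mulVec_smul, dotProduct_smul, smul_dotProduct, smul_eq_mul]
    field_simp
  have hcont : ContinuousOn f (Metric.sphere (0 : Fin n → ℝ) 1) := by
    refine ContinuousOn.div ?_ ?_ (fun y hy => (hPpos y (hne y hy)).ne')
    · exact (continuous_id.dotProduct (continuous_const.matrix_mulVec continuous_id)).continuousOn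
    · exact (continuous_id.dotProduct (continuous_const.matrix_mulVec continuous_id)).continuousOn
  obtain ⟨x0, hx0m, hmin⟩ := (isCompact_sphere (0 : Fin n → ℝ) 1).exists_isMinOn
    ⟨_, hmem x hx0⟩ hcont
  have hall : ∀ y : Fin n → ℝ, y ≠ 0 → f x0 ≤ f y := fun y hy => by
    rw [← hscale y hy]; exact hmin (hmem y hy)
  set μ := f x0 with hμ
  have hμneg : μ < 0 := lt_of_le_of_lt (hall x hx0) (div_neg_of_neg_of_pos hx (hPpos x hx0))
  have hx0ne := hne x0 hx0m
  have hY : (X - μ • P).PosSemidef := by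
    refine Matrix.PosSemidef.of_dotProduct_mulVec_nonneg ?_ ?_
    · have hPs : Pᵀ = P := hP.isHermitian
      change (X - μ • P)ᵀ = _
      rw [Matrix.transpose_sub, Matrix.transpose_smul, hX.eq, hPs]
    · intro y
      by_cases hy : y = 0
      · simp [hy]
      · have := (le_div_iff₀ (hPpos y hy)).1 (hall y hy)
        simp only [star_trivial, Matrix.sub_mulVec, Matrix.smul_mulVec, dotProduct_sub,
          dotProduct_smul, smul_eq_mul]
        linarith
  have hY0 : x0 ⬝ᵥ ((X - μ • P) *ᵥ x0) = 0 := by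
    simp only [Matrix.sub_mulVec, Matrix.smul_mulVec, dotProduct_sub,
          dotProduct_smul, smul_eq_mul]
    have : μ * (x0 ⬝ᵥ P *ᵥ x0) = x0 ⬝ᵥ X *ᵥ x0 := div_mul_cancel₀ _ (hPpos x0 hx0ne).ne'
    linarith
  have hLY := (aux_L E G σ hY).dotProduct_mulVec_nonneg x0
  have hid : (X - μ • P) = (Eᵀ * (X - μ • P) * E + σ ^ 2 • (Gᵀ * (X - μ • P) * G)) +
      ((X - (Eᵀ * X * E + σ ^ 2 • (Gᵀ * X * G))) +
        (-μ) • (-(Eᵀ * P * E + σ ^ 2 • (Gᵀ * P * G) - P))) := by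
    simp only [Matrix.mul_sub, Matrix.sub_mul, Matrix.mul_smul, Matrix.smul_mul]
    module
  have h1 := hXL.dotProduct_mulVec_nonneg x0
  have h2 := hL.dotProduct_mulVec_pos hx0ne
  have hadd : ∀ U V W : Matrix (Fin n) (Fin n) ℝ, x0 ⬝ᵥ ((U + (V + (-μ) • W)) *ᵥ x0) =
      x0 ⬝ᵥ (U *ᵥ x0) + (x0 ⬝ᵥ (V *ᵥ x0) + (-μ) * (x0 ⬝ᵥ (W *ᵥ x0))) := by
    intro U V W
    rw [Matrix.add_mulVec, Matrix.add_mulVec, dotProduct_add, dotProduct_add,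
      Matrix.smul_mulVec, dotProduct_smul, smul_eq_mul]
  rw [hid, hadd] at hY0
  simp only [star_trivial] at hLY h1 h2
  have := mul_pos (neg_pos.2 hμneg) h2
  linarith

lemma aux_mono {n : ℕ} (P : ℕ → Matrix (Fin n) (Fin n) ℝ) (hP : ∀ i, (P i).PosSemidef)
    (hd : ∀ i, (P i - P (i + 1)).PosSemidef) :
    ∃ X : Matrix (Fin n) (Fin n) ℝ, Tendsto P atTop (nhds X) ∧ X.PosSemidef := by
  have hconv : ∀ x : Fin n → ℝ, ∃ l, Tendsto (fun i => x ⬝ᵥ (P i *ᵥ x)) atTop (nhds l) := by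
    intro x
    refine ⟨_, tendsto_atTop_ciInf (antitone_nat_of_succ_le fun i => ?_) ⟨0, ?_⟩⟩
    · have := (hd i).dotProduct_mulVec_nonneg x
      simp only [star_trivial, Matrix.sub_mulVec, dotProduct_sub] at this
      linarith
    · rintro _ ⟨i, rfl⟩
      simpa using (hP i).dotProduct_mulVec_nonneg x
  choose l hl using hconv
  have hT : Tendsto P atTop (nhds (Matrix.of fun a b =>
      (l (Pi.single a 1 + Pi.single b 1) - l (Pi.single a 1) - l (Pi.single b 1)) / 2)) := by
    refine tendsto_pi_nhds.2 fun a => tendsto_pi_nhds.2 fun b => ?_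
    have h := (((hl (Pi.single a 1 + Pi.single b 1)).sub (hl (Pi.single a 1))).sub
      (hl (Pi.single b 1))).div_const 2
    refine h.congr fun i => ?_
    have hs : P i b a = P i a b := congrFun (congrFun (show (P i)ᵀ = P i from (hP i).isHermitian) a) b
    simp only [Matrix.mulVec_add, dotProduct_add, add_dotProduct, Matrix.mulVec_single_one,
      single_one_dotProduct, Matrix.col_apply, Pi.add_apply]
    rw [hs]; ring
  refine ⟨_, hT, Matrix.PosSemidef.of_dotProduct_mulVec_nonneg ?_ ?_⟩
  · ext a b
    simp [add_comm]
    ring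
  · intro x
    refine ge_of_tendsto' (f := fun i => star x ⬝ᵥ (P i *ᵥ x)) (x := atTop) ?_
      (fun i => (hP i).dotProduct_mulVec_nonneg x)
    exact ((continuous_const.dotProduct
      (continuous_id.matrix_mulVec continuous_const)).tendsto _).comp hT

lemma aux_expand {n m : ℕ} (A C : Matrix (Fin n) (Fin n) ℝ) (B D : Matrix (Fin n) (Fin m) ℝ)
    (σ : ℝ) (Q : Matrix (Fin n) (Fin n) ℝ) (S : Matrix (Fin m) (Fin n) ℝ)
    (R : Matrix (Fin m) (Fin m) ℝ) (P : Matrix (Fin n) (Fin n) ℝ) (hP : P.IsSymm)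
    (K : Matrix (Fin m) (Fin n) ℝ) :
    (A + B * K)ᵀ * P * (A + B * K) + σ ^ 2 • ((C + D * K)ᵀ * P * (C + D * K)) +
        (Kᵀ * R * K + Kᵀ * S + Sᵀ * K + Q) =
      (Kᵀ * (R + Bᵀ * P * B + σ ^ 2 • (Dᵀ * P * D)) * K +
        Kᵀ * (Bᵀ * P * A + σ ^ 2 • (Dᵀ * P * C) + S) +
        (Bᵀ * P * A + σ ^ 2 • (Dᵀ * P * C) + S)ᵀ * K) +
        (Q + Aᵀ * P * A + σ ^ 2 • (Cᵀ * P * C)) := by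
  simp only [Matrix.transpose_add, Matrix.transpose_mul, Matrix.transpose_smul, hP.eq,
    Matrix.transpose_transpose, Matrix.add_mul, Matrix.mul_add, Matrix.mul_assoc, Matrix.mul_smul,
    Matrix.smul_mul, smul_add]
  abel

theorem policy_iteration_converges_to_riccati
    (n m : ℕ) (hn : 0 < n) (hm : 0 < m)
    (A C : Matrix (Fin n) (Fin n) ℝ) (B D : Matrix (Fin n) (Fin m) ℝ)
    (σ : ℝ) (hσ : 0 < σ)
    (Q : Matrix (Fin n) (Fin n) ℝ) (hQ : Q.IsSymm)
    (S : Matrix (Fin m) (Fin n) ℝ)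
    (R : Matrix (Fin m) (Fin m) ℝ) (hR : R.PosDef)
    (hQS : (Q - Sᵀ * R⁻¹ * S).PosDef)
    (K : ℕ → Matrix (Fin m) (Fin n) ℝ)
    (P : ℕ → Matrix (Fin n) (Fin n) ℝ)
    (hK0 : IsStabilizer A C B D σ (K 0))
    (hPsymm : ∀ i, (P (i + 1)).IsSymm)
    (hlyap : ∀ i, (A + B * K i)ᵀ * P (i + 1) * (A + B * K i) +
        σ ^ 2 • ((C + D * K i)ᵀ * P (i + 1) * (C + D * K i)) +
        (K i)ᵀ * R * K i + (K i)ᵀ * S + Sᵀ * K i + Q - P (i + 1) = 0)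
    (hupd : ∀ i, K (i + 1) =
        -(R + Bᵀ * P (i + 1) * B + σ ^ 2 • (Dᵀ * P (i + 1) * D))⁻¹ *
          (Bᵀ * P (i + 1) * A + σ ^ 2 • (Dᵀ * P (i + 1) * C) + S)) :
    ∃ Pinf : Matrix (Fin n) (Fin n) ℝ,
      Tendsto P atTop (nhds Pinf) ∧
      Pinf.PosDef ∧
      Pinf = Q + Aᵀ * Pinf * A + σ ^ 2 • (Cᵀ * Pinf * C) -
        (Bᵀ * Pinf * A + σ ^ 2 • (Dᵀ * Pinf * C) + S)ᵀ *
          (R + Bᵀ * Pinf * B + σ ^ 2 • (Dᵀ * Pinf * D))⁻¹ *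
          (Bᵀ * Pinf * A + σ ^ 2 • (Dᵀ * Pinf * C) + S) ∧
      IsStabilizer A C B D σ
        (-(R + Bᵀ * Pinf * B + σ ^ 2 • (Dᵀ * Pinf * D))⁻¹ *
          (Bᵀ * Pinf * A + σ ^ 2 • (Dᵀ * Pinf * C) + S)) := by
  have hM : ∀ X : Matrix (Fin n) (Fin n) ℝ, X.PosSemidef →
      (R + Bᵀ * X * B + σ ^ 2 • (Dᵀ * X * D)).PosDef := fun X hX => by
    rw [add_assoc]; exact hR.add_posSemidef (aux_L B D σ hX)
  -- the evaluation equation makes `P` positive definite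
  have hpd : ∀ (X : Matrix (Fin n) (Fin n) ℝ) (k : Matrix (Fin m) (Fin n) ℝ), X.PosSemidef →
      ((A + B * k)ᵀ * X * (A + B * k) + σ ^ 2 • ((C + D * k)ᵀ * X * (C + D * k)) +
        (kᵀ * R * k + kᵀ * S + Sᵀ * k + Q) = X) → X.PosDef := fun X k hX h => by
    rw [← h]; exact Matrix.PosDef.posSemidef_add (aux_L _ _ σ hX) (aux_cost Q S R hR hQS k)
  have hE : ∀ i, (A + B * K i)ᵀ * P (i + 1) * (A + B * K i) +
        σ ^ 2 • ((C + D * K i)ᵀ * P (i + 1) * (C + D * K i)) +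
        ((K i)ᵀ * R * K i + (K i)ᵀ * S + Sᵀ * K i + Q) = P (i + 1) := fun i => by
    have := sub_eq_zero.1 (hlyap i)
    rw [← add_assoc, ← add_assoc, ← add_assoc]; exact this
  have hstab : ∀ i, IsStabilizer A C B D σ (K i) → (P (i + 1)).PosDef := by
    rintro i ⟨Y, hY, hYL⟩
    refine hpd _ _ (aux_compare _ _ σ Y _ hY hYL (hPsymm i) ?_) (hE i)
    rw [sub_eq_of_eq_add' (hE i).symm]
    exact (aux_cost Q S R hR hQS (K i)).posSemidef
  -- improvement inequality
  have himp : ∀ i, (P (i + 1)).PosDef → (P (i + 1) -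
      ((A + B * K (i + 1))ᵀ * P (i + 1) * (A + B * K (i + 1)) +
        σ ^ 2 • ((C + D * K (i + 1))ᵀ * P (i + 1) * (C + D * K (i + 1))) +
        ((K (i + 1))ᵀ * R * K (i + 1) + (K (i + 1))ᵀ * S + Sᵀ * K (i + 1) + Q))).PosSemidef := by
    intro i hPi
    have hMi := hM _ hPi.posSemidef
    have h1 := hE i
    rw [aux_expand _ _ _ _ _ _ _ _ _ (hPsymm i), aux_complete _ hMi] at h1
    rw [aux_expand _ _ _ _ _ _ _ _ _ (hPsymm i), aux_complete _ hMi]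
    have h0 : K (i + 1) + (R + Bᵀ * P (i + 1) * B + σ ^ 2 • (Dᵀ * P (i + 1) * D))⁻¹ *
          (Bᵀ * P (i + 1) * A + σ ^ 2 • (Dᵀ * P (i + 1) * C) + S) = 0 := by
      rw [hupd i, Matrix.neg_mul, neg_add_cancel]
    rw [h0]
    nth_rewrite 1 [← h1]
    convert aux_sandwich hMi.posSemidef (K i +
      (R + Bᵀ * P (i + 1) * B + σ ^ 2 • (Dᵀ * P (i + 1) * D))⁻¹ *
          (Bᵀ * P (i + 1) * A + σ ^ 2 • (Dᵀ * P (i + 1) * C) + S)) using 1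
    simp only [Matrix.mul_zero]
    abel
  have hnext : ∀ i, (P (i + 1)).PosDef → IsStabilizer A C B D σ (K (i + 1)) := by
    intro i hPi
    refine ⟨_, hPi, ?_⟩
    convert (aux_cost Q S R hR hQS (K (i + 1))).add_posSemidef (himp i hPi) using 1
    abel
  have hst : ∀ i, IsStabilizer A C B D σ (K i) := by
    intro i
    induction i with
    | zero => exact hK0
    | succ i ih => exact hnext i (hstab i ih)
  have hPpd : ∀ i, (P (i + 1)).PosDef := fun i => hstab i (hst i)
  have hdec : ∀ i, (P (i + 1) - P (i + 1 + 1)).PosSemidef := by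
    intro i
    obtain ⟨Y, hY, hYL⟩ := hst (i + 1)
    refine aux_compare _ _ σ Y _ hY hYL ((hPsymm i).sub (hPsymm (i + 1))) ?_
    convert himp i (hPpd i) using 1
    have h2 := hE (i + 1)
    rw [add_comm, ← eq_sub_iff_add_eq] at h2
    rw [h2]
    simp only [Matrix.mul_sub, Matrix.sub_mul, smul_sub]
    abel
  obtain ⟨X, hX, hXp⟩ := aux_mono (fun i => P (i + 1)) (fun i => (hPpd i).posSemidef) hdec
  have hXs : X.IsSymm := hXp.isHermitian
  have hMX := hM X hXp
  set k : Matrix (Fin m) (Fin n) ℝ := -(R + Bᵀ * X * B + σ ^ 2 • (Dᵀ * X * D))⁻¹ *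
          (Bᵀ * X * A + σ ^ 2 • (Dᵀ * X * C) + S) with hk
  have hKlim : Tendsto (fun i => K (i + 1)) atTop (nhds k) := by
    have hca : ContinuousAt (fun Y : Matrix (Fin n) (Fin n) ℝ =>
        -(R + Bᵀ * Y * B + σ ^ 2 • (Dᵀ * Y * D))⁻¹ *
          (Bᵀ * Y * A + σ ^ 2 • (Dᵀ * Y * C) + S)) X := by
      have hinv : ContinuousAt (fun Y : Matrix (Fin n) (Fin n) ℝ =>
          (R + Bᵀ * Y * B + σ ^ 2 • (Dᵀ * Y * D))⁻¹) X := by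
        refine ContinuousAt.comp (g := Inv.inv) ?_ ?_
        · refine continuousAt_matrix_inv _ ?_
          rw [Ring.inverse_eq_inv']
          exact continuousAt_inv₀ hMX.det_pos.ne'
        · exact Continuous.continuousAt (by fun_prop)
      have hc2 : ContinuousAt (fun Y : Matrix (Fin n) (Fin n) ℝ =>
          (Bᵀ * Y * A + σ ^ 2 • (Dᵀ * Y * C) + S)) X := Continuous.continuousAt (by fun_prop)
      have hmul : Continuous (fun p : Matrix (Fin m) (Fin m) ℝ × Matrix (Fin m) (Fin n) ℝ =>
        p.1 * p.2) := continuous_fst.matrix_mul continuous_snd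
      exact hmul.continuousAt.comp (hinv.neg.prodMk hc2)
    refine (hca.tendsto.comp hX).congr fun i => ?_
    exact (hupd i).symm
  have hEX : (A + B * k)ᵀ * X * (A + B * k) + σ ^ 2 • ((C + D * k)ᵀ * X * (C + D * k)) +
        (kᵀ * R * k + kᵀ * S + Sᵀ * k + Q) = X := by
    have hcont : Continuous (fun p : Matrix (Fin n) (Fin n) ℝ × Matrix (Fin m) (Fin n) ℝ =>
      (A + B * p.2)ᵀ * p.1 * (A + B * p.2) + σ ^ 2 • ((C + D * p.2)ᵀ * p.1 * (C + D * p.2)) +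
        (p.2ᵀ * R * p.2 + p.2ᵀ * S + Sᵀ * p.2 + Q)) := by fun_prop
    have hX' : Tendsto (fun i => P (i + 1 + 1)) atTop (nhds X) := hX.comp (tendsto_add_atTop_nat 1)
    refine tendsto_nhds_unique ?_ hX'
    refine ((hcont.tendsto (X, k)).comp (hX'.prodMk_nhds hKlim)).congr fun i => ?_
    exact hE (i + 1)
  have hXpd := hpd X k hXp hEX
  refine ⟨X, (tendsto_add_atTop_iff_nat 1).1 hX, hXpd, ?_, X, hXpd, ?_⟩
  · have h1 := hEX
    rw [aux_expand _ _ _ _ _ _ _ _ _ hXs, aux_complete _ hMX] at h1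
    have h0 : k + (R + Bᵀ * X * B + σ ^ 2 • (Dᵀ * X * D))⁻¹ *
          (Bᵀ * X * A + σ ^ 2 • (Dᵀ * X * C) + S) = 0 := by
      rw [hk, Matrix.neg_mul, neg_add_cancel]
    rw [h0, Matrix.mul_zero] at h1
    rw [zero_sub, neg_add_eq_sub] at h1
    exact h1.symm
  · rw [neg_sub, sub_eq_of_eq_add' hEX.symm]
    exact aux_cost Q S R hR hQS k
end

section
/- Let n, m be positive integers, A, C ∈ ℝ^{n×n}, B, D ∈ ℝ^{n×m}, σ > 0, and K ∈ ℝ^{m×n}; write F = A + BK and G = C + DK. Suppose there exists a symmetric positive definite n×n matrix P₀ such that Fᵀ P₀ F + σ² Gᵀ P₀ G − P₀ is negative definite. Then for every initial state ξ ∈ ℝⁿ, the real series ∑_{t=0}^∞ trace(W M_t) converges absolutely for every symmetric n×n matrix W, where M₀ = ξ ξᵀ and M_{t+1} = F M_t Fᵀ + σ² G M_t Gᵀ; in particular every infinite-horizon feedback cost J(K, ξ) = ∑_{t=0}^∞ trace(Q_K M_t) is finite. -/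
open Matrix Filter

open scoped MatrixOrder Matrix.Norms.L2Operator in
theorem psd_fact {n : ℕ} {P : Matrix (Fin n) (Fin n) ℝ} (h : P.PosSemidef) :
    ∃ L : Matrix (Fin n) (Fin n) ℝ, P = Lᵀ * L := by
  obtain ⟨L, hL⟩ := CStarAlgebra.nonneg_iff_eq_star_mul_self.1 h.nonneg
  exact ⟨L, by simpa [conjTranspose_eq_transpose_of_trivial, star_eq_conjTranspose] using hL⟩

theorem psd_conj {n : ℕ} {M : Matrix (Fin n) (Fin n) ℝ} (h : M.PosSemidef)
    (L : Matrix (Fin n) (Fin n) ℝ) : (L * M * Lᵀ).PosSemidef := by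
  simpa [conjTranspose_eq_transpose_of_trivial] using h.mul_mul_conjTranspose_same L

theorem psd_trace {n : ℕ} {P M : Matrix (Fin n) (Fin n) ℝ} (h : P.PosSemidef)
    (hM : M.PosSemidef) : 0 ≤ (P * M).trace := by
  obtain ⟨L, rfl⟩ := psd_fact h
  rw [Matrix.mul_assoc, Matrix.trace_mul_comm]
  exact (psd_conj hM L).trace_nonneg

theorem psd_entry {n : ℕ} {Y : Matrix (Fin n) (Fin n) ℝ} (h : Y.PosSemidef) (i j : Fin n) :
    |Y i j| ≤ Y.trace := by
  have hd : ∀ k, Y k k ≤ Y.trace := fun k =>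
    Finset.single_le_sum (f := fun k => Y k k) (fun k _ => h.diag_nonneg) (Finset.mem_univ k)
  have hs : Y j i = Y i j := by simpa using h.isHermitian.apply i j
  have h1 := h.dotProduct_mulVec_nonneg (Pi.single i 1 + Pi.single j 1)
  have h2 := h.dotProduct_mulVec_nonneg (Pi.single i 1 - Pi.single j 1)
  simp [Matrix.mulVec_add, Matrix.mulVec_sub, add_dotProduct, sub_dotProduct] at h1 h2
  have := hd i
  have := hd j
  rw [abs_le]
  constructor <;> linarith

theorem cost_summable_of_stabilizer
    (n m : ℕ) (hn : 0 < n) (hm : 0 < m)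
    (A C : Matrix (Fin n) (Fin n) ℝ) (B D : Matrix (Fin n) (Fin m) ℝ)
    (σ : ℝ) (hσ : 0 < σ) (K : Matrix (Fin m) (Fin n) ℝ)
    (F G : Matrix (Fin n) (Fin n) ℝ)
    (hF : F = A + B * K) (hG : G = C + D * K)
    (P₀ : Matrix (Fin n) (Fin n) ℝ) (hP₀ : P₀.PosDef)
    (hstab : (-(Fᵀ * P₀ * F + σ ^ 2 • (Gᵀ * P₀ * G) - P₀)).PosDef) :
    ∀ ξ : Fin n → ℝ, ∀ M : ℕ → Matrix (Fin n) (Fin n) ℝ,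
      M 0 = vecMulVec ξ ξ →
      (∀ t, M (t + 1) = F * M t * Fᵀ + σ ^ 2 • (G * M t * Gᵀ)) →
      (∀ W : Matrix (Fin n) (Fin n) ℝ, W.IsSymm →
        Summable (fun t => |(W * M t).trace|)) ∧
      (∀ (Q : Matrix (Fin n) (Fin n) ℝ) (S : Matrix (Fin m) (Fin n) ℝ)
          (R : Matrix (Fin m) (Fin m) ℝ),
        Summable (fun t =>
          ((Q + Kᵀ * S + Sᵀ * K + Kᵀ * R * K) * M t).trace)) := by
  intro ξ M h0 hM
  have hpsd : ∀ t, (M t).PosSemidef := by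
    intro t
    induction t with
    | zero => rw [h0]; simpa using posSemidef_vecMulVec_self_star ξ
    | succ t ih =>
      rw [hM]
      exact (psd_conj ih F).add ((psd_conj ih G).smul (sq_nonneg σ))
  generalize hN : -(Fᵀ * P₀ * F + σ ^ 2 • (Gᵀ * P₀ * G) - P₀) = N at hstab
  have hcyc : ∀ (H X : Matrix (Fin n) (Fin n) ℝ),
      (P₀ * (H * X * Hᵀ)).trace = (Hᵀ * P₀ * H * X).trace := by
    intro H X
    rw [← Matrix.mul_assoc, Matrix.trace_mul_comm]
    simp only [Matrix.mul_assoc]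
  have htel : ∀ t, (N * M t).trace = (P₀ * M t).trace - (P₀ * M (t + 1)).trace := by
    intro t
    rw [hM, ← hN, Matrix.mul_add, Matrix.mul_smul, trace_add, trace_smul, hcyc, hcyc]
    simp only [Matrix.neg_mul, Matrix.sub_mul, Matrix.add_mul, Matrix.smul_mul, trace_neg,
      trace_sub, trace_add, trace_smul]
    ring
  have hsum : Summable fun t => (N * M t).trace := by
    refine summable_of_sum_range_le (c := (P₀ * M 0).trace)
      (fun t => psd_trace hstab.posSemidef (hpsd t)) (fun t => ?_)
    simp only [htel]
    rw [Finset.sum_range_sub']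
    linarith [psd_trace hP₀.posSemidef (hpsd t)]
  obtain ⟨L, hL⟩ := psd_fact hstab.posSemidef
  have hLu : IsUnit L.det := by
    have := (Matrix.isUnit_iff_isUnit_det _).1 hstab.isUnit
    rw [hL, det_mul] at this
    exact isUnit_of_mul_isUnit_right this
  have hY : ∀ i j, Summable fun t => (L * M t * Lᵀ) i j := by
    intro i j
    refine Summable.of_norm_bounded hsum fun t => ?_
    rw [Real.norm_eq_abs, hL, Matrix.mul_assoc Lᵀ, Matrix.trace_mul_comm]
    exact psd_entry (psd_conj (hpsd t) L) i j
  have key : ∀ W : Matrix (Fin n) (Fin n) ℝ, Summable fun t => (W * M t).trace := by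
    intro W
    have hW : ∀ t, (W * M t).trace = (((L⁻¹)ᵀ * W * L⁻¹) * (L * M t * Lᵀ)).trace := by
      intro t
      have e : ((L⁻¹)ᵀ * W * L⁻¹) * (L * M t * Lᵀ) = (L⁻¹)ᵀ * (W * (L⁻¹ * L) * M t * Lᵀ) := by
        simp only [Matrix.mul_assoc]
      have e2 : W * M t * Lᵀ * (L⁻¹)ᵀ = W * M t := by
        rw [Matrix.mul_assoc, ← transpose_mul, nonsing_inv_mul _ hLu, transpose_one,
          Matrix.mul_one]
      rw [e, nonsing_inv_mul _ hLu, Matrix.trace_mul_comm (L⁻¹)ᵀ, Matrix.mul_one, e2]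
    simp only [hW]
    generalize (L⁻¹)ᵀ * W * L⁻¹ = V
    have hV : ∀ X : Matrix (Fin n) (Fin n) ℝ, (V * X).trace = ∑ i, ∑ j, V i j * X j i := by
      intro X
      simp only [trace, diag, Matrix.mul_apply]
    simp only [hV]
    exact summable_sum fun i _ => summable_sum fun j _ => (hY j i).mul_left _
  exact ⟨fun W _ => (key W).abs, fun Q S R => key _⟩
end
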